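/- arXiv:2507.19886 — 2 statements merged into one kernel-verified Lean document; each statement's English description precedes it below -/
import Mathlib

section
/- For every distribution μ ∈ D(Proc) and every predicate φ ⊆ Proc, the set of testing outcomes O^μ_φ is a nonempty subset of [0,1] that is convex: if x, y ∈ O^μ_φ and p ∈ [0,1], then p·x + (1−p)·y ∈ O^μ_φ. -/
open scoped Classical

/-- Finitely supported probability distributions on `α`. -/
structure FinDist (α : Type) where
  toFun : α → ℝ
  nonneg : ∀ a, 0 ≤ toFun a
  finite_support : (Function.support toFun).Finite
  sum_one : ∑ᶠ a, toFun a = 1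

namespace FinDist

/-- The probability that a predicate (set) `φ` is satisfied under `μ`. -/
noncomputable def mass {α : Type} (μ : FinDist α) (φ : Set α) : ℝ :=
  ∑ᶠ a ∈ φ, μ.toFun a

end FinDist

section Transitions

variable {Proc Act : Type}

/-- A single probabilistic transition between distributions: `μ →(α,p) ν` iff
`0 < p ≤ 1` and there are `P ∈ supp μ` and `ρ` with `P →α ρ` (single-step relation
`step`) and `ν = μ + μ(P)·p·(ρ − δ_P)`. -/
def DStep (step : Proc → Act → FinDist Proc → Prop)
    (μ : FinDist Proc) (α : Act) (p : ℝ) (ν : FinDist Proc) : Prop :=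
  0 < p ∧ p ≤ 1 ∧
    ∃ P ρ, 0 < μ.toFun P ∧ step P α ρ ∧
      ∀ Q, ν.toFun Q = μ.toFun Q + μ.toFun P * p * (ρ.toFun Q - (if Q = P then 1 else 0))

/-- Probabilistic transition sequence `μ →π ν` along a word `π`. -/
def DSeq (step : Proc → Act → FinDist Proc → Prop) :
    FinDist Proc → List (Act × ℝ) → FinDist Proc → Prop
  | μ, [], ν => ν = μ
  | μ, s :: π, ν => ∃ μ', DStep step μ s.1 s.2 μ' ∧ DSeq step μ' π ν

end Transitions
section Testing

variable {Proc Act : Type}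

/-- Internal transition sequence `μ ⇝ ν`: a finite composition of `→(τ,p)` steps. -/
def Internal (step : Proc → Act → FinDist Proc → Prop) (tau : Act)
    (μ ν : FinDist Proc) : Prop :=
  ∃ π : List (Act × ℝ), (∀ s ∈ π, s.1 = tau) ∧ DSeq step μ π ν

/-- Internal transition sequence with a degenerate witness (`every step has p = 1`),
written `μ →τ* ν`. -/
def Degenerate (step : Proc → Act → FinDist Proc → Prop) (tau : Act)
    (μ ν : FinDist Proc) : Prop :=
  ∃ π : List (Act × ℝ), (∀ s ∈ π, s.1 = tau ∧ s.2 = 1) ∧ DSeq step μ π ν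

/-- Testing outcomes `O^μ_φ = { ν(φ) : μ ⇝ ν }`. -/
def Outcomes (step : Proc → Act → FinDist Proc → Prop) (tau : Act)
    (φ : Set Proc) (μ : FinDist Proc) : Set ℝ :=
  {x | ∃ ν, Internal step tau μ ν ∧ x = ν.mass φ}

end Testing

theorem FinDist.ext_fun {α : Type} {μ ν : FinDist α} (h : ∀ a, μ.toFun a = ν.toFun a) :
    μ = ν := by
  cases μ; cases ν
  have := funext h
  simp only at this
  subst this
  rfl

/-- Convex combination of two distributions. -/
noncomputable def FinDist.mix {α : Type} (p : ℝ) (h0 : 0 ≤ p) (h1 : p ≤ 1)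
    (μ σ : FinDist α) : FinDist α where
  toFun a := p * μ.toFun a + (1 - p) * σ.toFun a
  nonneg a := add_nonneg (mul_nonneg h0 (μ.nonneg a))
    (mul_nonneg (by linarith) (σ.nonneg a))
  finite_support := by
    refine (μ.finite_support.union σ.finite_support).subset ?_
    intro a ha
    by_contra hc
    simp only [Set.mem_union, Function.mem_support, not_or, not_not] at hc
    apply ha
    simp [hc.1, hc.2]
  sum_one := by
    rw [finsum_add_distrib, ← mul_finsum, ← mul_finsum, μ.sum_one, σ.sum_one]
    · ring
    · exact μ.finite_support.subset (fun a ha h => ha (by simp [h]))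
    · exact σ.finite_support.subset (fun a ha h => ha (by simp [h]))

theorem FinDist.mass_eq_sum {α : Type} (μ : FinDist α) (φ : Set α) (s : Finset α)
    (hs : Function.support μ.toFun ⊆ s) :
    μ.mass φ = ∑ a ∈ s, if a ∈ φ then μ.toFun a else 0 := by
  unfold FinDist.mass
  have : ∀ a, (∑ᶠ (_ : a ∈ φ), μ.toFun a) = if a ∈ φ then μ.toFun a else 0 :=
    fun a => finsum_eq_if
  simp only [this]
  apply finsum_eq_sum_of_support_subset
  intro a ha
  apply hs
  intro h0
  apply ha
  simp [h0]

theorem FinDist.mass_mem {α : Type} (μ : FinDist α) (φ : Set α) :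
    μ.mass φ ∈ Set.Icc (0 : ℝ) 1 := by
  have hs : Function.support μ.toFun ⊆ μ.finite_support.toFinset := by simp
  rw [μ.mass_eq_sum φ _ hs]
  have h1 := μ.sum_one
  rw [finsum_eq_sum_of_support_subset _ hs] at h1
  constructor
  · apply Finset.sum_nonneg
    intro a _
    split_ifs
    · exact μ.nonneg a
    · exact le_rfl
  · rw [← h1]
    apply Finset.sum_le_sum
    intro a _
    split_ifs
    · exact le_rfl
    · exact μ.nonneg a

theorem FinDist.mass_mix {α : Type} (p : ℝ) (h0 : 0 ≤ p) (h1 : p ≤ 1)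
    (μ σ : FinDist α) (φ : Set α) :
    (FinDist.mix p h0 h1 μ σ).mass φ = p * μ.mass φ + (1 - p) * σ.mass φ := by
  have e1 : Function.support μ.toFun ⊆
      ((μ.finite_support.toFinset ∪ σ.finite_support.toFinset : Finset α) : Set α) := by
    simp
  have e2 : Function.support σ.toFun ⊆
      ((μ.finite_support.toFinset ∪ σ.finite_support.toFinset : Finset α) : Set α) := by
    simp
  have e3 : Function.support (FinDist.mix p h0 h1 μ σ).toFun ⊆
      ((μ.finite_support.toFinset ∪ σ.finite_support.toFinset : Finset α) : Set α) := by
    intro a ha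
    by_contra hc
    have a1 : μ.toFun a = 0 := by
      by_contra h
      exact hc (e1 h)
    have a2 : σ.toFun a = 0 := by
      by_contra h
      exact hc (e2 h)
    apply ha
    simp [FinDist.mix, a1, a2]
  rw [FinDist.mass_eq_sum _ φ _ e1, FinDist.mass_eq_sum _ φ _ e2,
    FinDist.mass_eq_sum _ φ _ e3, Finset.mul_sum, Finset.mul_sum, ← Finset.sum_add_distrib]
  apply Finset.sum_congr rfl
  intro a _
  split_ifs <;> simp [FinDist.mix]

theorem Internal.mix_left {Proc Act : Type} {step : Proc → Act → FinDist Proc → Prop}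
    {tau : Act} (p : ℝ) (hp : 0 < p) (h1 : p ≤ 1) (σ : FinDist Proc)
    {μ ν : FinDist Proc} (h : Internal step tau μ ν) :
    Internal step tau (FinDist.mix p hp.le h1 μ σ) (FinDist.mix p hp.le h1 ν σ) := by
  obtain ⟨π, hπ, hs⟩ := h
  induction π generalizing μ with
  | nil =>
    have e : ν = μ := hs
    subst e
    exact ⟨[], by simp, rfl⟩
  | cons s π ih =>
    obtain ⟨μ', ⟨hq0, hq1, P, ρ, hP, hst, heq⟩, hs⟩ := hs
    obtain ⟨π', hπ', hs'⟩ := ih (fun t ht => hπ t (List.mem_cons_of_mem _ ht)) hs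
    have hσ := mul_nonneg (sub_nonneg.2 h1) (σ.nonneg P)
    have hpP := mul_pos hp hP
    have hm : 0 < p * μ.toFun P + (1 - p) * σ.toFun P := by linarith
    refine ⟨(s.1, p * μ.toFun P * s.2 / (p * μ.toFun P + (1 - p) * σ.toFun P)) :: π', ?_,
      FinDist.mix p hp.le h1 μ' σ, ⟨?_, ?_, P, ρ, hm, hst, ?_⟩, hs'⟩
    · intro t ht
      rcases List.mem_cons.1 ht with rfl | ht
      · exact hπ s List.mem_cons_self
      · exact hπ' t ht
    · exact div_pos (mul_pos hpP hq0) hm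
    · rw [div_le_one hm]
      nlinarith
    · intro Q
      simp only [FinDist.mix]
      rw [mul_div_cancel₀ _ hm.ne', heq Q]
      ring

theorem DSeq.append_tr {Proc Act : Type} {step : Proc → Act → FinDist Proc → Prop}
    {l1 l2 : List (Act × ℝ)} {a b c : FinDist Proc} (h1 : DSeq step a l1 b)
    (h2 : DSeq step b l2 c) : DSeq step a (l1 ++ l2) c := by
  induction l1 generalizing a with
  | nil =>
    have e : b = a := h1
    subst e
    exact h2
  | cons s l ih =>
    obtain ⟨m, hm, hr⟩ := h1
    exact ⟨m, hm, ih hr⟩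

theorem Internal.trans_tr {Proc Act : Type} {step : Proc → Act → FinDist Proc → Prop}
    {tau : Act} {a b c : FinDist Proc} (h1 : Internal step tau a b)
    (h2 : Internal step tau b c) : Internal step tau a c := by
  obtain ⟨l1, ht1, hs1⟩ := h1
  obtain ⟨l2, ht2, hs2⟩ := h2
  refine ⟨l1 ++ l2, ?_, hs1.append_tr hs2⟩
  intro s hs
  rcases List.mem_append.1 hs with h | h
  · exact ht1 s h
  · exact ht2 s h

/-- The set of testing outcomes `O^μ_φ` is a nonempty convex subset
of `[0,1]`. -/
theorem outcomes_nonempty_convex_subset_Icc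
    {Proc Act : Type} (step : Proc → Act → FinDist Proc → Prop) (tau : Act)
    (μ : FinDist Proc) (φ : Set Proc) :
    (Outcomes step tau φ μ).Nonempty ∧
    Outcomes step tau φ μ ⊆ Set.Icc (0 : ℝ) 1 ∧
    (∀ x ∈ Outcomes step tau φ μ, ∀ y ∈ Outcomes step tau φ μ,
      ∀ p : ℝ, 0 ≤ p → p ≤ 1 → p * x + (1 - p) * y ∈ Outcomes step tau φ μ) := by
  refine ⟨⟨_, μ, ⟨[], by simp, rfl⟩, rfl⟩, ?_, ?_⟩
  · rintro x ⟨ν, _, rfl⟩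
    exact ν.mass_mem φ
  · rintro x ⟨ν, hν, rfl⟩ y ⟨ν', hν', rfl⟩ p h0 h1
    rcases h0.eq_or_lt with rfl | hp
    · exact ⟨ν', hν', by ring⟩
    rcases h1.eq_or_lt with rfl | hp1
    · exact ⟨ν, hν, by ring⟩
    refine ⟨FinDist.mix p h0 h1 ν ν', ?_, (FinDist.mass_mix p h0 h1 ν ν' φ).symm⟩
    have hq : 0 < 1 - p := by linarith
    have hq1 : 1 - p ≤ 1 := by linarith
    have s1 := Internal.mix_left p hp h1 μ hν
    have s2 := Internal.mix_left (1 - p) hq hq1 ν hν'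
    have e0 : FinDist.mix p hp.le h1 μ μ = μ := by
      apply FinDist.ext_fun
      intro a
      simp only [FinDist.mix]
      ring
    have e : ∀ κ : FinDist Proc, FinDist.mix (1 - p) hq.le hq1 κ ν =
        FinDist.mix p hp.le h1 ν κ := by
      intro κ
      apply FinDist.ext_fun
      intro a
      simp only [FinDist.mix]
      ring
    rw [e0] at s1
    rw [e, e] at s2
    exact s1.trans_tr s2
end

section
/- Let φ ⊆ Proc be a predicate and μ, ν ∈ D(Proc) distributions. If μ ⇝ ν, then there exist distributions ν1, ν2 ∈ D(Proc) such that μ →τ* ν1 and μ →τ* ν2 (internal transition sequences with degenerate witnesses) and sup O^{ν1}_φ ≤ sup O^ν_φ ≤ sup O^{ν2}_φ. -/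
open scoped Classical

namespace FinDist

theorem ext_fun_s6 {α : Type} {μ ν : FinDist α} (h : ∀ a, μ.toFun a = ν.toFun a) : μ = ν := by
  cases μ; cases ν
  simp only [FinDist.mk.injEq]
  exact funext h

/-- The affine combination `μ + c (ρ - σ)`, when nonnegative. -/
noncomputable def aff {α : Type} (μ : FinDist α) (c : ℝ) (ρ σ : FinDist α)
    (h : ∀ a, 0 ≤ μ.toFun a + c * (ρ.toFun a - σ.toFun a)) : FinDist α where
  toFun a := μ.toFun a + c * (ρ.toFun a - σ.toFun a)
  nonneg := h
  finite_support := by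
    refine ((μ.finite_support.union ρ.finite_support).union σ.finite_support).subset ?_
    intro a ha
    by_contra hn
    simp only [Set.mem_union, Function.mem_support, not_or, not_not] at hn
    apply ha
    simp [hn.1.1, hn.1.2, hn.2]
  sum_one := by
    have h1 : (Function.support fun a => ρ.toFun a - σ.toFun a).Finite := by
      refine (ρ.finite_support.union σ.finite_support).subset ?_
      exact Function.support_sub _ _
    have h2 : (Function.support fun a => c * (ρ.toFun a - σ.toFun a)).Finite := by
      refine h1.subset ?_
      intro a ha hn
      apply ha
      simp only [hn, mul_zero]
    rw [finsum_add_distrib μ.finite_support h2, ← mul_finsum,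
      finsum_sub_distrib ρ.finite_support σ.finite_support, μ.sum_one, ρ.sum_one, σ.sum_one]
    ring

/-- Dirac distribution. -/
noncomputable def dirac {α : Type} (P : α) : FinDist α where
  toFun Q := if Q = P then 1 else 0
  nonneg a := by split_ifs <;> norm_num
  finite_support := by
    refine (Set.finite_singleton P).subset ?_
    intro a ha
    by_contra hn
    apply ha
    exact if_neg hn
  sum_one := by
    rw [finsum_eq_single _ P]
    · simp
    · intro x hx
      simp [hx]

/-- Convex combination `a μ + (1 - a) κ`. -/
noncomputable def mix_s6 {α : Type} (a : ℝ) (h0 : 0 ≤ a) (h1 : a ≤ 1) (μ κ : FinDist α) :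
    FinDist α :=
  aff μ (1 - a) κ μ (fun x => by
    nlinarith [μ.nonneg x, κ.nonneg x, mul_nonneg h0 (μ.nonneg x),
      mul_nonneg (sub_nonneg.2 h1) (κ.nonneg x)])

theorem mix_apply {α : Type} (a : ℝ) (h0 : 0 ≤ a) (h1 : a ≤ 1) (μ κ : FinDist α) (x : α) :
    (mix_s6 a h0 h1 μ κ).toFun x = a * μ.toFun x + (1 - a) * κ.toFun x := by
  simp only [mix_s6, aff]; ring

/-- The result of moving the fraction `p` of the mass at `P` to `ρ`. -/
noncomputable def push {α : Type} (P : α) (ρ : FinDist α) (p : ℝ) (h0 : 0 ≤ p) (h1 : p ≤ 1)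
    (μ : FinDist α) : FinDist α :=
  aff μ (μ.toFun P * p) ρ (dirac P) (fun x => by
    have hP := μ.nonneg P
    have hr := mul_nonneg (mul_nonneg hP h0) (ρ.nonneg x)
    by_cases hx : x = P
    · subst hx
      simp only [dirac, if_true]
      nlinarith [mul_nonneg hP (sub_nonneg.2 h1)]
    · simp only [dirac, if_neg hx]
      nlinarith [μ.nonneg x])

theorem push_apply {α : Type} (P : α) (ρ : FinDist α) (p : ℝ) (h0 : 0 ≤ p) (h1 : p ≤ 1)
    (μ : FinDist α) (x : α) : (push P ρ p h0 h1 μ).toFun x =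
      μ.toFun x + μ.toFun P * p * (ρ.toFun x - (if x = P then 1 else 0)) := rfl

theorem mass_mix_s6 {α : Type} (φ : Set α) (a : ℝ) (h0 : 0 ≤ a) (h1 : a ≤ 1) (μ κ : FinDist α) :
    (mix_s6 a h0 h1 μ κ).mass φ = a * μ.mass φ + (1 - a) * κ.mass φ := by
  have key : ∀ (c : ℝ) (μ : FinDist α),
      (Function.support fun x => c * φ.indicator μ.toFun x).Finite := by
    intro c μ
    refine μ.finite_support.subset ?_
    intro x hx hn
    apply hx
    by_cases hx : x ∈ φ <;> simp [hx, hn]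
  unfold mass
  rw [finsum_mem_def, finsum_mem_def, finsum_mem_def, mul_finsum,
    mul_finsum, ← finsum_add_distrib (key a μ) (key (1 - a) κ)]
  refine finsum_congr fun x => ?_
  by_cases hx : x ∈ φ
  · simp [hx, mix_apply]
  · simp [hx]

theorem mass_le_one {α : Type} (φ : Set α) (μ : FinDist α) : μ.mass φ ≤ 1 := by
  rw [← μ.sum_one]
  unfold mass
  rw [finsum_mem_def]
  refine finsum_le_finsum' ?_ μ.finite_support ?_
  · refine μ.finite_support.subset ?_
    intro x hx hn
    apply hx
    by_cases hx : x ∈ φ <;> simp [hx, hn]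
  · intro x
    exact Set.indicator_le_self' (fun y _ => μ.nonneg y) x

end FinDist

open FinDist

section Aux

variable {Proc Act : Type} {step : Proc → Act → FinDist Proc → Prop} {tau : Act}

/-- Internal sequence of length at most `n`. -/
def IntN (step : Proc → Act → FinDist Proc → Prop) (tau : Act) (n : ℕ)
    (μ ν : FinDist Proc) : Prop :=
  ∃ π : List (Act × ℝ), π.length ≤ n ∧ (∀ s ∈ π, s.1 = tau) ∧ DSeq step μ π ν

theorem IntN.refl (n : ℕ) (μ : FinDist Proc) : IntN step tau n μ μ :=
  ⟨[], by simp, by simp, rfl⟩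

theorem IntN.push {n : ℕ} {P : Proc} {ρ : FinDist Proc} (hs : step P tau ρ) {p : ℝ}
    (h0 : 0 < p) (h1 : p ≤ 1) {μ ν : FinDist Proc}
    (h : IntN step tau n (push P ρ p h0.le h1 μ) ν) : IntN step tau (n + 1) μ ν := by
  obtain ⟨π, hl, ht, hd⟩ := h
  rcases (μ.nonneg P).eq_or_lt with hP | hP
  · have : FinDist.push P ρ p h0.le h1 μ = μ := ext_fun_s6 fun x => by
      rw [push_apply, ← hP]; ring
    rw [this] at hd
    exact ⟨π, by omega, ht, hd⟩
  · refine ⟨(tau, p) :: π, by simpa using hl, by simpa using ht, _,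
      ⟨h0, h1, P, ρ, hP, hs, fun Q => push_apply _ _ _ _ _ _ _⟩, hd⟩

/-- Decomposition of sequences out of a mixture. -/
theorem IntN.decomp {a : ℝ} (h0 : 0 ≤ a) (h1 : a ≤ 1) : ∀ (n : ℕ) (μ κ ν : FinDist Proc),
    IntN step tau n (mix_s6 a h0 h1 μ κ) ν →
    ∃ μ' κ', IntN step tau n μ μ' ∧ IntN step tau n κ κ' ∧ ν = mix_s6 a h0 h1 μ' κ' := by
  intro n
  induction n with
  | zero =>
    rintro μ κ ν ⟨π, hl, ht, hd⟩
    obtain rfl : π = [] := by simpa using hl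
    exact ⟨μ, κ, IntN.refl _ _, IntN.refl _ _, hd⟩
  | succ n ih =>
    rintro μ κ ν ⟨π, hl, ht, hd⟩
    cases π with
    | nil => exact ⟨μ, κ, IntN.refl _ _, IntN.refl _ _, hd⟩
    | cons s π =>
      obtain ⟨μ1, ⟨hp0, hp1, P, ρ, hP, hs, hq⟩, hd⟩ := hd
      have hst : s.1 = tau := ht s (by simp)
      rw [hst] at hs
      have e : μ1 = mix_s6 a h0 h1 (FinDist.push P ρ s.2 hp0.le hp1 μ)
          (FinDist.push P ρ s.2 hp0.le hp1 κ) := ext_fun_s6 fun x => by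
        rw [hq, mix_apply, mix_apply, mix_apply, push_apply, push_apply]
        ring
      subst e
      obtain ⟨μ', κ', hμ, hκ, e⟩ := ih _ _ ν
        ⟨π, by simpa using hl, fun t h => ht t (by simp [h]), hd⟩
      exact ⟨μ', κ', hμ.push hs hp0 hp1, hκ.push hs hp0 hp1, e⟩

theorem DSeq.append {μ ν κ : FinDist Proc} {π π' : List (Act × ℝ)} (h : DSeq step μ π ν)
    (h' : DSeq step ν π' κ) : DSeq step μ (π ++ π') κ := by
  induction π generalizing μ with
  | nil => cases h; exact h'
  | cons s π ih =>
    obtain ⟨μ1, hs, hd⟩ := h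
    exact ⟨μ1, hs, ih hd⟩

theorem Internal.trans' {μ ν κ : FinDist Proc} (h : Internal step tau μ ν)
    (h' : Internal step tau ν κ) : Internal step tau μ κ := by
  obtain ⟨π, ht, hd⟩ := h
  obtain ⟨π', ht', hd'⟩ := h'
  refine ⟨π ++ π', ?_, hd.append hd'⟩
  intro s hs
  rcases List.mem_append.1 hs with h | h
  · exact ht s h
  · exact ht' s h

theorem Internal.refl' (μ : FinDist Proc) : Internal step tau μ μ :=
  ⟨[], by simp, rfl⟩

theorem Internal.mixLeft {a : ℝ} (h0 : 0 < a) (h1 : a ≤ 1) {μ ν : FinDist Proc}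
    (κ : FinDist Proc) (h : Internal step tau μ ν) :
    Internal step tau (mix_s6 a h0.le h1 μ κ) (mix_s6 a h0.le h1 ν κ) := by
  obtain ⟨π, ht, hd⟩ := h
  induction π generalizing μ with
  | nil => cases hd; exact Internal.refl' _
  | cons s π ih =>
    obtain ⟨μ1, ⟨hp0, hp1, P, ρ, hP, hs, hq⟩, hd⟩ := hd
    have hst : s.1 = tau := ht s (by simp)
    rw [hst] at hs
    refine Internal.trans' ?_ (ih (fun t h => ht t (by simp [h])) hd)
    have hA : 0 < a * μ.toFun P := mul_pos h0 hP
    have hB : 0 ≤ (1 - a) * κ.toFun P := mul_nonneg (sub_nonneg.2 h1) (κ.nonneg P)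
    have hAB : 0 < a * μ.toFun P + (1 - a) * κ.toFun P := by linarith
    refine ⟨[(tau, s.2 * (a * μ.toFun P) / (a * μ.toFun P + (1 - a) * κ.toFun P))], by simp,
      _, ⟨?_, ?_, P, ρ, ?_, hs, ?_⟩, rfl⟩
    · exact div_pos (mul_pos hp0 hA) hAB
    · simp only
      rw [div_le_one hAB]
      nlinarith
    · rw [mix_apply]; exact hAB
    · intro Q
      simp only [mix_apply]
      rw [mul_div_cancel₀ _ hAB.ne', hq]
      ring

theorem mix_symm {a : ℝ} (h0 : 0 ≤ a) (h1 : a ≤ 1) (μ κ : FinDist Proc) :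
    mix_s6 a h0 h1 μ κ = mix_s6 (1 - a) (sub_nonneg.2 h1) (by linarith) κ μ :=
  ext_fun_s6 fun x => by rw [mix_apply, mix_apply]; ring

theorem Internal.mixBoth {a : ℝ} (h0 : 0 < a) (h1 : a < 1) {μ ν κ ξ : FinDist Proc}
    (h : Internal step tau μ ν) (h' : Internal step tau κ ξ) :
    Internal step tau (mix_s6 a h0.le h1.le μ κ) (mix_s6 a h0.le h1.le ν ξ) := by
  refine (h.mixLeft h0 h1.le κ).trans' ?_
  rw [mix_symm _ _ ν κ, mix_symm _ _ ν ξ]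
  exact h'.mixLeft (sub_pos.2 h1) (by linarith) ν

theorem outcomes_bdd (φ : Set Proc) (μ : FinDist Proc) :
    BddAbove (Outcomes step tau φ μ) :=
  ⟨1, by rintro x ⟨ν, -, rfl⟩; exact mass_le_one _ _⟩

theorem outcomes_ne (φ : Set Proc) (μ : FinDist Proc) :
    (Outcomes step tau φ μ).Nonempty :=
  ⟨_, μ, Internal.refl' μ, rfl⟩

theorem sup_concave (φ : Set Proc) {a : ℝ} (h0 : 0 < a) (h1 : a < 1) (μ κ : FinDist Proc) :
    a * sSup (Outcomes step tau φ μ) + (1 - a) * sSup (Outcomes step tau φ κ) ≤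
      sSup (Outcomes step tau φ (mix_s6 a h0.le h1.le μ κ)) := by
  refine le_of_forall_pos_le_add fun ε hε => ?_
  obtain ⟨x, ⟨ν, hν, rfl⟩, hx⟩ := exists_lt_of_lt_csSup (outcomes_ne (step := step) (tau := tau) φ μ)
    (sub_lt_self _ hε)
  obtain ⟨y, ⟨ξ, hξ, rfl⟩, hy⟩ := exists_lt_of_lt_csSup (outcomes_ne (step := step) (tau := tau) φ κ)
    (sub_lt_self _ hε)
  have := le_csSup (outcomes_bdd φ _) ⟨_, hν.mixBoth h0 h1 hξ, rfl⟩
  rw [mass_mix_s6] at this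
  nlinarith

theorem lower_aux (φ : Set Proc) : ∀ (n : ℕ) (μ ν : FinDist Proc), IntN step tau n μ ν →
    ∃ ν1, Degenerate step tau μ ν1 ∧
      sSup (Outcomes step tau φ ν1) ≤ sSup (Outcomes step tau φ ν) := by
  intro n
  induction n with
  | zero =>
    rintro μ ν ⟨π, hl, ht, hd⟩
    obtain rfl : π = [] := by simpa using hl
    cases hd
    exact ⟨_, ⟨[], by simp, rfl⟩, le_rfl⟩
  | succ n ih =>
    rintro μ ν ⟨π, hl, ht, hd⟩
    cases π with
    | nil => cases hd; exact ⟨_, ⟨[], by simp, rfl⟩, le_rfl⟩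
    | cons s π =>
      obtain ⟨μ1, ⟨hp0, hp1, P, ρ, hP, hs, hq⟩, hd⟩ := hd
      have hst : s.1 = tau := ht s (by simp)
      rw [hst] at hs
      have e : μ1 = mix_s6 s.2 hp0.le hp1 (FinDist.push P ρ 1 zero_le_one le_rfl μ) μ :=
        ext_fun_s6 fun x => by
          rw [hq, mix_apply, push_apply]
          ring
      subst e
      obtain ⟨νb, νa, hb, ha, e⟩ := IntN.decomp hp0.le hp1 n _ _ ν
        ⟨π, by simpa using hl, fun t h => ht t (by simp [h]), hd⟩
      obtain ⟨νb1, ⟨πb, htb, hdb⟩, hbl⟩ := ih _ _ hb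
      obtain ⟨νa1, ha1, hal⟩ := ih _ _ ha
      have hb1 : Degenerate step tau μ νb1 := by
        refine ⟨(tau, 1) :: πb, ?_, _, ⟨one_pos, le_rfl, P, ρ, hP, hs, ?_⟩, hdb⟩
        · intro t h
          rcases List.mem_cons.1 h with rfl | h
          · exact ⟨rfl, rfl⟩
          · exact htb t h
        · exact fun Q => push_apply _ _ _ _ _ _ _
      rcases hp1.eq_or_lt with h | h
      · have : ν = νb := by
          rw [e]
          exact ext_fun_s6 fun x => by rw [mix_apply, h]; ring
        exact ⟨νb1, hb1, this ▸ hbl⟩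
      · have hc := sup_concave (step := step) (tau := tau) φ hp0 h νb νa
        rw [← e] at hc
        rcases le_total (sSup (Outcomes step tau φ νb)) (sSup (Outcomes step tau φ νa)) with h' | h'
        · exact ⟨νb1, hb1, by nlinarith⟩
        · exact ⟨νa1, ha1, by nlinarith⟩

end Aux

/-- Any internal transition sequence can be lower and upper
approximated, with respect to the supremum of testing outcomes, by internal
transition sequences with degenerate witnesses. -/
theorem outcome_bounded_by_degenerate_witness
    {Proc Act : Type} (step : Proc → Act → FinDist Proc → Prop) (tau : Act)
    (φ : Set Proc) (μ ν : FinDist Proc) (h : Internal step tau μ ν) :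
    ∃ ν1 ν2 : FinDist Proc,
      Degenerate step tau μ ν1 ∧ Degenerate step tau μ ν2 ∧
      sSup (Outcomes step tau φ ν1) ≤ sSup (Outcomes step tau φ ν) ∧
      sSup (Outcomes step tau φ ν) ≤ sSup (Outcomes step tau φ ν2) := by
  obtain ⟨π, ht, hd⟩ := h
  obtain ⟨ν1, hν1, hle⟩ := lower_aux (step := step) (tau := tau) φ π.length μ ν
    ⟨π, le_rfl, ht, hd⟩
  refine ⟨ν1, μ, hν1, ⟨[], by simp, rfl⟩, hle, ?_⟩
  refine csSup_le_csSup (outcomes_bdd φ μ) (outcomes_ne φ ν) ?_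
  rintro x ⟨κ, hκ, rfl⟩
  exact ⟨κ, Internal.trans' ⟨π, ht, hd⟩ hκ, rfl⟩
end
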